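/- arXiv:1904.11156 — 3 statements merged into one kernel-verified Lean document; each statement's English description precedes it below -/
import Mathlib

section
/- Let Ψ be a real T×P matrix such that Ψ'Ψ is invertible, and let ε₁,…,εₙ be random vectors in ℝ^T, uncorrelated across i, each with mean zero and finite covariance matrix Σᵢ. Set Σ̄ = (1/n)∑ᵢ Σᵢ and ε̄ = (1/n)∑ᵢ εᵢ. Then E‖(Ψ'Ψ/T)⁻¹ Ψ' ε̄‖² ≤ T·P·λ_max(Σ̄) / (n·λ_min(Ψ'Ψ/T)), where ‖·‖ is the Euclidean norm on ℝ^P and λ_max, λ_min denote the largest and smallest eigenvalues of a symmetric matrix. -/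
open MeasureTheory Matrix
open scoped BigOperators

/-- Smallest eigenvalue of a symmetric matrix, via the Rayleigh quotient
(Courant–Fischer characterization). -/
noncomputable def eigMin {m : Type*} [Fintype m] (M : Matrix m m ℝ) : ℝ :=
  sInf {r : ℝ | ∃ x : m → ℝ, x ⬝ᵥ x = 1 ∧ r = x ⬝ᵥ M.mulVec x}

/-- Largest eigenvalue of a symmetric matrix, via the Rayleigh quotient. -/
noncomputable def eigMax {m : Type*} [Fintype m] (M : Matrix m m ℝ) : ℝ :=
  sSup {r : ℝ | ∃ x : m → ℝ, x ⬝ᵥ x = 1 ∧ r = x ⬝ᵥ M.mulVec x}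

section RayleighQuotient

variable {m : Type*} [Fintype m]

theorem isCompact_rayleigh_values (M : Matrix m m ℝ) :
    IsCompact {r : ℝ | ∃ x : m → ℝ, x ⬝ᵥ x = 1 ∧ r = x ⬝ᵥ M.mulVec x} := by
  have hsphere : IsCompact {x : m → ℝ | x ⬝ᵥ x = 1} := by
    refine Metric.isCompact_of_isClosed_isBounded ?_ ?_
    · exact isClosed_eq (by fun_prop) continuous_const
    · refine (Metric.isBounded_closedBall (x := (0 : m → ℝ)) (r := 1)).subset fun x hx => ?_
      rw [mem_closedBall_zero_iff, pi_norm_le_iff_of_nonneg zero_le_one]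
      intro i
      have h : x i * x i ≤ x ⬝ᵥ x :=
        Finset.single_le_sum (f := fun j => x j * x j)
          (fun j _ => mul_self_nonneg (x j)) (Finset.mem_univ i)
      rw [Set.mem_ofPred_eq] at hx
      rw [Real.norm_eq_abs, abs_le]
      constructor <;> nlinarith
  have himage := hsphere.image (f := fun x : m → ℝ => x ⬝ᵥ M.mulVec x) (by fun_prop)
  convert himage using 1
  ext r
  simp only [Set.mem_ofPred_eq, Set.mem_image]
  exact exists_congr fun x => and_congr_right fun _ => eq_comm

theorem exists_unit_smul {x : m → ℝ} (hx : x ≠ 0) :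
    ∃ (c : ℝ) (y : m → ℝ), y ⬝ᵥ y = 1 ∧ x = c • y ∧ x ⬝ᵥ x = c * c := by
  have hpos : 0 < x ⬝ᵥ x := by
    simpa using Matrix.dotProduct_star_self_pos_iff.2 hx
  have hs := Real.mul_self_sqrt hpos.le
  have hs0 : Real.sqrt (x ⬝ᵥ x) ≠ 0 := (Real.sqrt_pos.2 hpos).ne'
  refine ⟨Real.sqrt (x ⬝ᵥ x), (Real.sqrt (x ⬝ᵥ x))⁻¹ • x, ?_, ?_, hs.symm⟩
  · rw [smul_dotProduct, dotProduct_smul, smul_eq_mul, smul_eq_mul]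
    field_simp
    rw [sq, hs]
  · rw [smul_smul, mul_inv_cancel₀ hs0, one_smul]

theorem dotProduct_mulVec_le_eigMax (M : Matrix m m ℝ) (x : m → ℝ) :
    x ⬝ᵥ M.mulVec x ≤ eigMax M * (x ⬝ᵥ x) := by
  by_cases hx : x = 0
  · simp [hx]
  obtain ⟨c, y, hy, rfl, hc⟩ := exists_unit_smul hx
  have h : y ⬝ᵥ M.mulVec y ≤ eigMax M :=
    le_csSup (isCompact_rayleigh_values M).bddAbove ⟨y, hy, rfl⟩
  rw [hc, mulVec_smul, smul_dotProduct, dotProduct_smul, smul_eq_mul, smul_eq_mul]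
  nlinarith [mul_self_nonneg c]

theorem eigMin_le_dotProduct_mulVec (M : Matrix m m ℝ) (x : m → ℝ) :
    eigMin M * (x ⬝ᵥ x) ≤ x ⬝ᵥ M.mulVec x := by
  by_cases hx : x = 0
  · simp [hx]
  obtain ⟨c, y, hy, rfl, hc⟩ := exists_unit_smul hx
  have h : eigMin M ≤ y ⬝ᵥ M.mulVec y :=
    csInf_le (isCompact_rayleigh_values M).bddBelow ⟨y, hy, rfl⟩
  rw [hc, mulVec_smul, smul_dotProduct, dotProduct_smul, smul_eq_mul, smul_eq_mul]
  nlinarith [mul_self_nonneg c]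

theorem eigMin_pos [Nonempty m] {M : Matrix m m ℝ} (hM : M.PosDef) : 0 < eigMin M := by
  classical
  obtain ⟨i⟩ := ‹Nonempty m›
  obtain ⟨x, hx, hr⟩ := (isCompact_rayleigh_values M).sInf_mem
    ⟨_, Pi.single i 1, by simp, rfl⟩
  have hx0 : x ≠ 0 := by
    rintro rfl
    simp at hx
  have h := hM.dotProduct_mulVec_pos hx0
  rw [star_trivial, ← hr] at h
  exact h

theorem eigMax_nonneg [Nonempty m] {M : Matrix m m ℝ} (hM : M.PosSemidef) : 0 ≤ eigMax M := by
  classical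
  obtain ⟨i⟩ := ‹Nonempty m›
  have h := dotProduct_mulVec_le_eigMax M (Pi.single i 1)
  have h0 := hM.dotProduct_mulVec_nonneg (Pi.single i 1)
  rw [star_trivial] at h0
  simpa using h0.trans h

theorem inv_apply_self_le_inv_eigMin [DecidableEq m] {M : Matrix m m ℝ} (hM : M.PosDef) (i : m) :
    M⁻¹ i i ≤ (eigMin M)⁻¹ := by
  have : Nonempty m := ⟨i⟩
  have hpos : 0 < M⁻¹ i i := hM.inv.diag_pos
  set y : m → ℝ := M⁻¹.mulVec (Pi.single i 1) with hy
  have hyi : y i = M⁻¹ i i := by simp [hy]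
  have hMy : M.mulVec y = Pi.single i 1 := by
    rw [hy, mulVec_mulVec, mul_nonsing_inv _ ((isUnit_iff_isUnit_det M).1 hM.isUnit), one_mulVec]
  have h := eigMin_le_dotProduct_mulVec M y
  rw [hMy, dotProduct_single, mul_one, hyi] at h
  have hsq : y i * y i ≤ y ⬝ᵥ y :=
    Finset.single_le_sum (f := fun j => y j * y j)
      (fun j _ => mul_self_nonneg (y j)) (Finset.mem_univ i)
  rw [hyi] at hsq
  have hmin := eigMin_pos hM
  have h' : eigMin M * (M⁻¹ i i * M⁻¹ i i) ≤ M⁻¹ i i :=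
    (mul_le_mul_of_nonneg_left hsq hmin.le).trans h
  rw [le_inv_comm₀ hpos hmin, ← one_div, le_div_iff₀ hpos]
  nlinarith

end RayleighQuotient

/-- Second moment of a linear functional of the average of uncorrelated random vectors. -/
theorem integrable_and_integral_sq_dotProduct_average {Ω ι τ : Type*} [MeasurableSpace Ω]
    {μ : Measure Ω} [Fintype ι] [Fintype τ] {ε : ι → Ω → τ → ℝ} {S : ι → Matrix τ τ ℝ}
    (hint : ∀ i i' t t', Integrable (fun ω => ε i ω t * ε i' ω t') μ)
    (hcov : ∀ i t t', ∫ ω, ε i ω t * ε i ω t' ∂μ = S i t t')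
    (huncorr : ∀ i i', i ≠ i' → ∀ t t', ∫ ω, ε i ω t * ε i' ω t' ∂μ = 0)
    (c : ℝ) (v : τ → ℝ) :
    Integrable (fun ω => (v ⬝ᵥ fun t => c * ∑ i, ε i ω t) * (v ⬝ᵥ fun t => c * ∑ i, ε i ω t)) μ ∧
    ∫ ω, (v ⬝ᵥ fun t => c * ∑ i, ε i ω t) * (v ⬝ᵥ fun t => c * ∑ i, ε i ω t) ∂μ =
      c * (v ⬝ᵥ (c • ∑ i, S i).mulVec v) := by
  classical
  have hexp : (fun ω => (v ⬝ᵥ fun t => c * ∑ i, ε i ω t) * (v ⬝ᵥ fun t => c * ∑ i, ε i ω t)) =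
      fun ω => ∑ t, ∑ t', ∑ i, ∑ i', (c * c * v t * v t') * (ε i ω t * ε i' ω t') := by
    funext ω
    rw [dotProduct, Finset.sum_mul_sum]
    refine Finset.sum_congr rfl fun t _ => Finset.sum_congr rfl fun t' _ => ?_
    simp only [← Finset.mul_sum, ← Finset.sum_mul]
    ring
  have hterm : ∀ t t' i i',
      Integrable (fun ω => (c * c * v t * v t') * (ε i ω t * ε i' ω t')) μ :=
    fun t t' i i' => (hint i i' t t').const_mul _
  have hi3 : ∀ t t' i, Integrable
      (fun ω => ∑ i', (c * c * v t * v t') * (ε i ω t * ε i' ω t')) μ :=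
    fun t t' i => integrable_finsetSum _ fun i' _ => hterm t t' i i'
  have hi2 : ∀ t t', Integrable
      (fun ω => ∑ i, ∑ i', (c * c * v t * v t') * (ε i ω t * ε i' ω t')) μ :=
    fun t t' => integrable_finsetSum _ fun i _ => hi3 t t' i
  have hi1 : ∀ t, Integrable
      (fun ω => ∑ t', ∑ i, ∑ i', (c * c * v t * v t') * (ε i ω t * ε i' ω t')) μ :=
    fun t => integrable_finsetSum _ fun t' _ => hi2 t t'
  rw [hexp]
  refine ⟨integrable_finsetSum _ fun t _ => hi1 t, ?_⟩
  rw [integral_finsetSum _ fun t _ => hi1 t]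
  simp only [dotProduct, mulVec, Finset.mul_sum]
  refine Finset.sum_congr rfl fun t _ => ?_
  rw [integral_finsetSum _ fun t' _ => hi2 t t']
  refine Finset.sum_congr rfl fun t' _ => ?_
  rw [integral_finsetSum _ fun i _ => hi3 t t' i]
  have hi : ∀ i, ∫ ω, ∑ i', (c * c * v t * v t') * (ε i ω t * ε i' ω t') ∂μ =
      c * c * v t * v t' * S i t t' := by
    intro i
    rw [integral_finsetSum _ fun i' _ => hterm t t' i i', Finset.sum_eq_single i]
    · rw [integral_const_mul, hcov]
    · intro i' _ hne
      rw [integral_const_mul, huncorr i i' hne.symm, mul_zero]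
    · simp
  simp only [hi]
  simp only [← Finset.mul_sum, Matrix.smul_apply, Matrix.sum_apply, smul_eq_mul]
  ring

theorem variance_bound_eigMax
    {Ω : Type*} [MeasurableSpace Ω] (μ : Measure Ω) [IsProbabilityMeasure μ]
    (T P n : ℕ) (hT : 0 < T) (hP : 0 < P) (hn : 0 < n)
    (Ψ : Matrix (Fin T) (Fin P) ℝ) (hΨ : IsUnit (Ψᵀ * Ψ).det)
    (ε : Fin n → Ω → Fin T → ℝ) (Sigm : Fin n → Matrix (Fin T) (Fin T) ℝ)
    (hmeas : ∀ i, Measurable (ε i))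
    (hint : ∀ i i' t t', Integrable (fun ω => ε i ω t * ε i' ω t') μ)
    (hmean : ∀ i t, ∫ ω, ε i ω t ∂μ = 0)
    (hcov : ∀ i t t', ∫ ω, ε i ω t * ε i ω t' ∂μ = Sigm i t t')
    (hpd : ∀ i, (Sigm i).PosDef)
    (huncorr : ∀ i i', i ≠ i' → ∀ t t', ∫ ω, ε i ω t * ε i' ω t' ∂μ = 0) :
    ∫ ω,
        ((((T : ℝ)⁻¹ • (Ψᵀ * Ψ))⁻¹.mulVec
            (Ψᵀ.mulVec (fun t => (n : ℝ)⁻¹ * ∑ i, ε i ω t))) ⬝ᵥ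
          (((T : ℝ)⁻¹ • (Ψᵀ * Ψ))⁻¹.mulVec
            (Ψᵀ.mulVec (fun t => (n : ℝ)⁻¹ * ∑ i, ε i ω t)))) ∂μ ≤
      (T : ℝ) * (P : ℝ) * eigMax ((n : ℝ)⁻¹ • ∑ i, Sigm i) /
        ((n : ℝ) * eigMin ((T : ℝ)⁻¹ • (Ψᵀ * Ψ))) := by
  have : Nonempty (Fin T) := ⟨⟨0, hT⟩⟩
  have : Nonempty (Fin P) := ⟨⟨0, hP⟩⟩
  have hT' : (0 : ℝ) < T := Nat.cast_pos.2 hT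
  have hn' : (0 : ℝ) < n := Nat.cast_pos.2 hn
  have hgram : (Ψᵀ * Ψ).PosDef := by
    have hsemi : (Ψᵀ * Ψ).PosSemidef := by
      simpa using Matrix.posSemidef_conjTranspose_mul_self Ψ
    exact hsemi.posDef_iff_isUnit.2 ((isUnit_iff_isUnit_det _).2 hΨ)
  set G : Matrix (Fin P) (Fin P) ℝ := (T : ℝ)⁻¹ • (Ψᵀ * Ψ) with hG
  have hGpd : G.PosDef := hgram.smul (inv_pos.2 hT')
  have hGdet : IsUnit G.det := (isUnit_iff_isUnit_det G).1 hGpd.isUnit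
  set S : Matrix (Fin T) (Fin T) ℝ := (n : ℝ)⁻¹ • ∑ i, Sigm i with hS
  have hSpd : S.PosSemidef :=
    (Matrix.posSemidef_sum _ fun i _ => (hpd i).posSemidef).smul (inv_pos.2 hn').le
  have hmax := eigMax_nonneg hSpd
  have hmin := eigMin_pos hGpd
  set L : Matrix (Fin P) (Fin T) ℝ := G⁻¹ * Ψᵀ with hL
  have hLL : L * Lᵀ = (T : ℝ) • G⁻¹ := by
    have hGT : (G⁻¹)ᵀ = G⁻¹ := by simpa using hGpd.inv.isHermitian.eq
    have hgramG : Ψᵀ * Ψ = (T : ℝ) • G := by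
      rw [hG, smul_smul, mul_inv_cancel₀ hT'.ne', one_smul]
    rw [hL, transpose_mul, transpose_transpose, hGT, Matrix.mul_assoc, ← Matrix.mul_assoc Ψᵀ,
      hgramG, smul_mul_assoc, mul_nonsing_inv _ hGdet, mul_smul_comm, Matrix.mul_one]
  have hrow : ∀ p, L p ⬝ᵥ L p = T * G⁻¹ p p := fun p => by
    simpa [Matrix.mul_apply, dotProduct] using congrFun (congrFun hLL p) p
  have hmoment := fun p =>
    integrable_and_integral_sq_dotProduct_average hint hcov huncorr (n : ℝ)⁻¹ (L p)
  simp only [mulVec_mulVec, ← hL]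
  calc _ = ∫ ω, ∑ p, (L p ⬝ᵥ fun t => (n : ℝ)⁻¹ * ∑ i, ε i ω t) *
          (L p ⬝ᵥ fun t => (n : ℝ)⁻¹ * ∑ i, ε i ω t) ∂μ := rfl
    _ = ∑ p, (n : ℝ)⁻¹ * (L p ⬝ᵥ S.mulVec (L p)) := by
        rw [integral_finsetSum _ fun p _ => (hmoment p).1]
        exact Finset.sum_congr rfl fun p _ => (hmoment p).2
    _ ≤ ∑ _p : Fin P, (n : ℝ)⁻¹ * (eigMax S * (T * (eigMin G)⁻¹)) := by
        refine Finset.sum_le_sum fun p _ => ?_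
        have h := dotProduct_mulVec_le_eigMax S (L p)
        rw [hrow] at h
        have hinv := inv_apply_self_le_inv_eigMin hGpd p
        refine mul_le_mul_of_nonneg_left (h.trans ?_) (inv_pos.2 hn').le
        gcongr
    _ = _ := by
        rw [Finset.sum_const, Finset.card_univ, Fintype.card_fin, nsmul_eq_mul]
        field_simp
end

section
/- Let Ψ be a real T×P matrix with Ψ'Ψ invertible, Ψ̃ a real R×P matrix, and Σ̄ a T×T symmetric positive definite matrix such that θ := Σ̄^{1/2}Ψ(Ψ'Ψ)⁻¹Ψ̃' has θ'θ invertible. Let ε₁,…,εₙ be random vectors in ℝ^T whose components satisfy E|ε_{it}|^{2+δ} < ∞ for some δ > 0. Then for every unit vector v ∈ ℝ^R, ∑_{i=1}^n E| n^{-1/2} v'(θ'θ)^{-1/2}θ'Σ̄^{-1/2}εᵢ |^{2+δ} ≤ T^{1+δ/2}·max_{i,t} E|ε_{it}|^{2+δ} / ( n^{δ/2}·λ_min(Σ̄)^{1+δ/2} ). -/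
open MeasureTheory Matrix
open scoped BigOperators

/-- Cauchy–Schwarz for the dot product of real vectors. -/
theorem dotProduct_sq_le {m : Type*} [Fintype m] (x y : m → ℝ) :
    (x ⬝ᵥ y) ^ 2 ≤ (x ⬝ᵥ x) * (y ⬝ᵥ y) := by
  have h := Finset.sum_mul_sq_le_sq_mul_sq Finset.univ x y
  simpa only [dotProduct, sq] using h

theorem dotProduct_self_nonneg_real {m : Type*} [Fintype m] (x : m → ℝ) : 0 ≤ x ⬝ᵥ x :=
  Finset.sum_nonneg fun i _ => mul_self_nonneg (x i)

theorem eigMin_mul_dotProduct_self_le {m : Type*} [Fintype m] {M : Matrix m m ℝ}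
    (hM : ∀ x : m → ℝ, 0 ≤ x ⬝ᵥ M *ᵥ x) (x : m → ℝ) :
    eigMin M * (x ⬝ᵥ x) ≤ x ⬝ᵥ M *ᵥ x := by
  rcases (dotProduct_self_nonneg_real x).eq_or_lt with h | h
  · rw [← h, mul_zero]
    exact hM x
  · have hs : 0 < Real.sqrt (x ⬝ᵥ x) := Real.sqrt_pos.2 h
    have hss := Real.mul_self_sqrt h.le
    set s := Real.sqrt (x ⬝ᵥ x)
    have hle : eigMin M ≤ (s⁻¹ • x) ⬝ᵥ M *ᵥ (s⁻¹ • x) := by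
      refine csInf_le ⟨0, ?_⟩ ⟨s⁻¹ • x, ?_, rfl⟩
      · rintro r ⟨y, -, rfl⟩
        exact hM y
      · rw [smul_dotProduct, dotProduct_smul, smul_eq_mul, smul_eq_mul, ← hss]
        field_simp
    rw [mulVec_smul, smul_dotProduct, dotProduct_smul, smul_eq_mul, smul_eq_mul] at hle
    calc eigMin M * (x ⬝ᵥ x) ≤ s⁻¹ * (s⁻¹ * (x ⬝ᵥ M *ᵥ x)) * (x ⬝ᵥ x) := by gcongr
      _ = x ⬝ᵥ M *ᵥ x := by rw [← hss]; field_simp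

theorem mulVec_dotProduct_self_le {l m : Type*} [Fintype l] [Fintype m] (A : Matrix l m ℝ)
    (x : m → ℝ) : (A *ᵥ x) ⬝ᵥ (A *ᵥ x) ≤ (∑ i, A i ⬝ᵥ A i) * (x ⬝ᵥ x) := by
  rw [Finset.sum_mul]
  refine Finset.sum_le_sum fun i _ => ?_
  rw [← sq]
  exact dotProduct_sq_le (A i) x

theorem dotProduct_mul_self_mulVec {m : Type*} [Fintype m] {S : Matrix m m ℝ} (hS : Sᵀ = S)
    (x : m → ℝ) : x ⬝ᵥ (S * S) *ᵥ x = (S *ᵥ x) ⬝ᵥ (S *ᵥ x) := by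
  rw [← mulVec_mulVec, dotProduct_mulVec, ← mulVec_transpose, hS]

theorem eigMin_mul_self_pos {m : Type*} [Fintype m] [DecidableEq m] [Nonempty m]
    {S : Matrix m m ℝ} (hS : Sᵀ = S) (hdet : IsUnit S.det) : 0 < eigMin (S * S) := by
  set C : ℝ := ∑ i, S⁻¹ i ⬝ᵥ S⁻¹ i
  have hC : 0 ≤ C := Finset.sum_nonneg fun i _ => dotProduct_self_nonneg_real _
  refine lt_of_lt_of_le (show 0 < 1 / (C + 1) by positivity) (le_csInf ?_ ?_)
  · obtain ⟨i⟩ := ‹Nonempty m›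
    exact ⟨_, Pi.single i 1, by simp, rfl⟩
  · rintro r ⟨x, hx, rfl⟩
    rw [dotProduct_mul_self_mulVec hS, div_le_iff₀ (by positivity)]
    have h := mulVec_dotProduct_self_le S⁻¹ (S *ᵥ x)
    rw [mulVec_mulVec, nonsing_inv_mul S hdet, one_mulVec, hx] at h
    nlinarith [dotProduct_self_nonneg_real (S *ᵥ x)]

theorem dotProduct_self_rpow_le {m : Type*} [Fintype m] (x : m → ℝ) {δ : ℝ} (hδ : 0 ≤ δ) :
    (x ⬝ᵥ x) ^ (1 + δ / 2) ≤ (Fintype.card m : ℝ) ^ (δ / 2) * ∑ t, |x t| ^ (2 + δ) := by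
  have h := Real.rpow_sum_le_const_mul_sum_rpow Finset.univ (fun t => x t * x t)
    (show 1 ≤ 1 + δ / 2 by linarith)
  have hx : ∀ t, |x t * x t| ^ (1 + δ / 2) = |x t| ^ (2 + δ) := fun t => by
    rw [abs_mul, ← sq, ← Real.rpow_natCast, ← Real.rpow_mul (abs_nonneg _)]
    congr 1
    push_cast
    ring
  simp only [hx, add_sub_cancel_left] at h
  simpa only [dotProduct, abs_mul_self, Finset.card_univ] using h

/-- The moment bound for a linear form whose coefficient vector has squared norm at most `c`. -/
theorem abs_dotProduct_rpow_le {m : Type*} [Fintype m] (w x : m → ℝ) {c δ : ℝ} (hδ : 0 ≤ δ)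
    (hw : w ⬝ᵥ w ≤ c) :
    |w ⬝ᵥ x| ^ (2 + δ) ≤
      c ^ (1 + δ / 2) * ((Fintype.card m : ℝ) ^ (δ / 2) * ∑ t, |x t| ^ (2 + δ)) := by
  have hc : 0 ≤ c := (dotProduct_self_nonneg_real w).trans hw
  have hx := dotProduct_self_nonneg_real x
  calc |w ⬝ᵥ x| ^ (2 + δ) = (|w ⬝ᵥ x| ^ 2) ^ (1 + δ / 2) := by
        rw [← Real.rpow_natCast, ← Real.rpow_mul (abs_nonneg _)]
        congr 1
        push_cast
        ring
    _ ≤ (c * (x ⬝ᵥ x)) ^ (1 + δ / 2) := by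
        rw [sq_abs]
        gcongr
        exact (dotProduct_sq_le w x).trans (by gcongr)
    _ = c ^ (1 + δ / 2) * (x ⬝ᵥ x) ^ (1 + δ / 2) := Real.mul_rpow hc hx
    _ ≤ _ := by
        gcongr
        exact dotProduct_self_rpow_le x hδ

theorem lyapunov_condition_bound
    {Ω : Type*} [MeasurableSpace Ω] (μ : Measure Ω) [IsProbabilityMeasure μ]
    (T P R n : ℕ) (hT : 0 < T) (hP : 0 < P) (hR : 0 < R) (hn : 0 < n)
    (δ : ℝ) (hδ : 0 < δ)
    (Ψ : Matrix (Fin T) (Fin P) ℝ) (hΨ : IsUnit (Ψᵀ * Ψ).det)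
    (Ψt : Matrix (Fin R) (Fin P) ℝ)
    (Sb : Matrix (Fin T) (Fin T) ℝ) (hSb : Sb.PosDef)
    -- `S = Σ̄^{1/2}`: the symmetric positive definite square root of `Σ̄`
    (S : Matrix (Fin T) (Fin T) ℝ) (hS : S.PosDef) (hSS : S * S = Sb)
    -- `θ = Σ̄^{1/2} Ψ (Ψ'Ψ)⁻¹ Ψ̃'`, with `θ'θ` invertible
    (θ : Matrix (Fin T) (Fin R) ℝ) (hθ : θ = S * Ψ * (Ψᵀ * Ψ)⁻¹ * Ψtᵀ)
    (hθθ : IsUnit (θᵀ * θ).det)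
    -- `B = (θ'θ)^{-1/2}`: the symmetric positive definite square root of `(θ'θ)⁻¹`
    (B : Matrix (Fin R) (Fin R) ℝ) (hB : B.PosDef) (hBB : (θᵀ * θ) * (B * B) = 1)
    (ε : Fin n → Ω → Fin T → ℝ)
    (hmeas : ∀ i, Measurable (ε i))
    (hmom : ∀ i t, Integrable (fun ω => |ε i ω t| ^ ((2 : ℝ) + δ)) μ) :
    ∀ v : Fin R → ℝ, v ⬝ᵥ v = 1 →
      ∑ i, ∫ ω,
          |(n : ℝ) ^ (-(1 : ℝ) / 2) * (v ⬝ᵥ (B * θᵀ * S⁻¹).mulVec (ε i ω))| ^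
            ((2 : ℝ) + δ) ∂μ ≤
        (T : ℝ) ^ ((1 : ℝ) + δ / 2) *
            (⨆ i, ⨆ t, ∫ ω, |ε i ω t| ^ ((2 : ℝ) + δ) ∂μ) /
          ((n : ℝ) ^ (δ / 2) * eigMin Sb ^ ((1 : ℝ) + δ / 2)) := by
  intro v hv
  have : Nonempty (Fin T) := ⟨⟨0, hT⟩⟩
  have hSt : Sᵀ = S := by simpa using hS.isHermitian.eq
  have hBt : Bᵀ = B := by simpa using hB.isHermitian.eq
  have hSdet : IsUnit S.det := hS.det_pos.ne'.isUnit
  have hlam : 0 < eigMin Sb := hSS ▸ eigMin_mul_self_pos hSt hSdet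
  set L := eigMin Sb
  set w : Fin T → ℝ := v ᵥ* (B * θᵀ * S⁻¹) with hw
  have hSw : S *ᵥ w = θ *ᵥ (B *ᵥ v) := by
    rw [hw, ← mulVec_transpose, mulVec_mulVec, mulVec_mulVec]
    congr 1
    rw [transpose_mul, transpose_mul, transpose_transpose, hBt, transpose_nonsing_inv, hSt,
      mul_nonsing_inv_cancel_left _ _ hSdet]
  have hBθB : B * ((θᵀ * θ) * B) = 1 := by
    rw [mul_eq_one_comm, Matrix.mul_assoc, hBB]
  have hunit : (S *ᵥ w) ⬝ᵥ (S *ᵥ w) = 1 := by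
    rw [hSw, mulVec_mulVec, dotProduct_mulVec, ← mulVec_transpose, mulVec_mulVec, transpose_mul,
      hBt, Matrix.mul_assoc, ← Matrix.mul_assoc θᵀ, hBθB, one_mulVec, hv]
  have hww : w ⬝ᵥ w ≤ 1 / L := by
    have h := eigMin_mul_dotProduct_self_le (M := Sb) (fun x => by
      rw [← hSS, dotProduct_mul_self_mulVec hSt]
      exact dotProduct_self_nonneg_real _) w
    rw [le_div_iff₀ hlam, mul_comm]
    rwa [← hunit, ← dotProduct_mul_self_mulVec hSt, hSS]
  set K := ⨆ i, ⨆ t, ∫ ω, |ε i ω t| ^ ((2 : ℝ) + δ) ∂μ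
  have hK : ∀ i t, ∫ ω, |ε i ω t| ^ ((2 : ℝ) + δ) ∂μ ≤ K := fun i t =>
    (le_ciSup (f := fun t => ∫ ω, |ε i ω t| ^ ((2 : ℝ) + δ) ∂μ)
      (Set.finite_range _).bddAbove t).trans
      (le_ciSup (f := fun i => ⨆ t, ∫ ω, |ε i ω t| ^ ((2 : ℝ) + δ) ∂μ)
        (Set.finite_range _).bddAbove i)
  have hn' : (0 : ℝ) < n := by exact_mod_cast hn
  have hT' : (0 : ℝ) < T := by exact_mod_cast hT
  set N : ℝ := (n : ℝ) ^ (-(1 + δ / 2))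
  have hscale : ((n : ℝ) ^ (-(1 : ℝ) / 2)) ^ ((2 : ℝ) + δ) = N := by
    rw [← Real.rpow_mul hn'.le]
    congr 1
    ring
  have hterm : ∀ i, ∫ ω,
      |(n : ℝ) ^ (-(1 : ℝ) / 2) * (v ⬝ᵥ (B * θᵀ * S⁻¹).mulVec (ε i ω))| ^ ((2 : ℝ) + δ) ∂μ ≤
        N * ((1 / L) ^ (1 + δ / 2) * ((T : ℝ) ^ (δ / 2) * (T * K))) := fun i => by
    calc _ ≤ ∫ ω, N * ((1 / L) ^ (1 + δ / 2) *
            ((T : ℝ) ^ (δ / 2) * ∑ t, |ε i ω t| ^ ((2 : ℝ) + δ))) ∂μ := by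
          refine integral_mono_of_nonneg (ae_of_all _ fun ω => by positivity) ?_
            (ae_of_all _ fun ω => ?_)
          · exact (((integrable_finsetSum _ fun t _ => hmom i t).const_mul _).const_mul _).const_mul _
          · dsimp only
            rw [abs_mul, Real.mul_rpow (abs_nonneg _) (abs_nonneg _),
              abs_of_nonneg (Real.rpow_nonneg hn'.le _), hscale, dotProduct_mulVec]
            gcongr
            simpa using abs_dotProduct_rpow_le w (ε i ω) hδ.le hww
      _ = N * ((1 / L) ^ (1 + δ / 2) *
            ((T : ℝ) ^ (δ / 2) * ∑ t, ∫ ω, |ε i ω t| ^ ((2 : ℝ) + δ) ∂μ)) := by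
          rw [integral_const_mul, integral_const_mul, integral_const_mul,
            integral_finsetSum _ fun t _ => hmom i t]
      _ ≤ _ := by
          gcongr
          simpa using Finset.sum_le_sum fun t (_ : t ∈ Finset.univ) => hK i t
  calc _ ≤ ∑ _i : Fin n, N * ((1 / L) ^ (1 + δ / 2) * ((T : ℝ) ^ (δ / 2) * (T * K))) :=
        Finset.sum_le_sum fun i _ => hterm i
    _ = _ := by
        have hN : (n : ℝ) * N = ((n : ℝ) ^ (δ / 2))⁻¹ := by
          rw [← Real.rpow_neg hn'.le, ← Real.rpow_one_add' hn'.le (by linarith)]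
          congr 1
          ring
        rw [Finset.sum_const, Finset.card_univ, Fintype.card_fin, nsmul_eq_mul, ← mul_assoc, hN,
          Real.div_rpow zero_le_one hlam.le, Real.one_rpow, Real.rpow_add hT', Real.rpow_one]
        field_simp
end

section
/- Let x₁,…,x_T be points in the unit cube [0,1]^d, let Λ be a finite set of multi-indices in ℕ^d with |Λ| = P, and let Ψ be the T×P matrix with entries Ψ_{t,λ} = x_t^λ := ∏_{k=1}^d (x_{t,k})^{λ_k} for λ ∈ Λ. Let Q_P be the P×P matrix with entries (Q_P)_{λ,λ'} = ∫_{[0,1]^d} x^{λ+λ'} dx = ∏_{k=1}^d 1/(λ_k + λ'_k + 1). Let D*(x₁,…,x_T) := sup_{a ∈ [0,1]^d} | (1/T)·#{t : x_{t,k} < a_k for all k} − ∏_{k=1}^d a_k | be the star discrepancy of the point set. Then ‖Ψ'Ψ/T − Q_P‖_F ≤ P·2^d·D*(x₁,…,x_T), where ‖·‖_F is the Frobenius norm. -/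
open Matrix
open scoped BigOperators

open MeasureTheory
open scoped unitInterval

/-- The local discrepancy of the points `x t` at the anchored box `∏ k, [0, a k)`. -/
noncomputable def localDiscrepancy {T : ℕ} {κ : Type*} [Fintype κ]
    (x : Fin T → κ → ℝ) (a : κ → ℝ) : ℝ :=
  (T : ℝ)⁻¹ * ∑ t, ∏ k, (if x t k < a k then 1 else 0) - ∏ k, a k

theorem localDiscrepancy_eq_ncard {T : ℕ} {κ : Type*} [Fintype κ]
    (x : Fin T → κ → ℝ) (a : κ → ℝ) :
    localDiscrepancy x a =
      (T : ℝ)⁻¹ * (Set.ncard {t : Fin T | ∀ k, x t k < a k} : ℝ) - ∏ k, a k := by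
  classical
  rw [localDiscrepancy, Set.ncard_eq_toFinset_card', Set.toFinset_ofPred, Finset.card_filter]
  simp [Fintype.prod_ite_zero]

theorem abs_localDiscrepancy_le_one {T : ℕ} {κ : Type*} [Fintype κ] (hT : 0 < T)
    (x : Fin T → κ → ℝ) {a : κ → ℝ} (ha : ∀ k, a k ∈ Set.Icc (0 : ℝ) 1) :
    |localDiscrepancy x a| ≤ 1 := by
  rw [localDiscrepancy_eq_ncard]
  have hT' : (0 : ℝ) < T := by exact_mod_cast hT
  have hcard : (Set.ncard {t : Fin T | ∀ k, x t k < a k} : ℝ) ≤ T := by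
    exact_mod_cast (Set.ncard_le_card _).trans_eq (by simp)
  have h₁ : (T : ℝ)⁻¹ * (Set.ncard {t : Fin T | ∀ k, x t k < a k} : ℝ) ≤ 1 := by
    rw [inv_mul_le_iff₀ hT', mul_one]
    exact hcard
  have h₀ : 0 ≤ (T : ℝ)⁻¹ * (Set.ncard {t : Fin T | ∀ k, x t k < a k} : ℝ) := by positivity
  have h₂ : ∏ k, a k ≤ 1 := Finset.prod_le_one (fun k _ => (ha k).1) fun k _ => (ha k).2
  have h₃ : 0 ≤ ∏ k, a k := Finset.prod_nonneg fun k _ => (ha k).1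
  rw [abs_le]
  constructor <;> linarith

/-- Inclusion-exclusion: the discrepancy of a half-open box with upper corner `1` is an alternating
sum of discrepancies of anchored boxes. -/
theorem discrepancy_halfOpenBox_eq_sum {T : ℕ} {κ : Type*} [Fintype κ] [DecidableEq κ]
    (x : Fin T → κ → ℝ) (u : κ → ℝ) :
    (T : ℝ)⁻¹ * ∑ t, ∏ k, ((if x t k < 1 then 1 else 0) - (if x t k < u k then 1 else 0) : ℝ)
        - ∏ k, (1 - u k) =
      ∑ s : Finset κ, (-1) ^ s.card * localDiscrepancy x (fun k => if k ∈ s then u k else 1) := by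
  have key (f g : κ → ℝ) : ∏ k, (f k - g k) =
      ∑ s : Finset κ, (-1) ^ s.card * ∏ k, if k ∈ s then g k else f k := by
    rw [Finset.prod_sub, Finset.powerset_univ]
    refine Finset.sum_congr rfl fun s _ => ?_
    rw [mul_assoc, mul_comm (∏ i ∈ Finset.univ \ s, f i), Finset.prod_ite]
    simp [Finset.filter_not]
  simp_rw [key, localDiscrepancy, mul_sub, Finset.sum_sub_distrib, Finset.mul_sum]
  rw [Finset.sum_comm]
  congr 1
  refine Finset.sum_congr rfl fun s _ => Finset.sum_congr rfl fun t _ => ?_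
  rw [mul_left_comm]
  congr 3 with k
  split_ifs <;> rfl

/-- Every closed box with upper corner `1` has discrepancy at most `2 ^ d` times the star
discrepancy. The boundary points missed by half-open boxes are absorbed into the term of the
full cube. -/
theorem abs_discrepancy_closedBox_le {T : ℕ} {κ : Type*} [Fintype κ] (hT : 0 < T)
    {x : Fin T → κ → ℝ} {D : ℝ}
    (hD : ∀ a : κ → ℝ, (∀ k, a k ∈ Set.Icc (0 : ℝ) 1) → |localDiscrepancy x a| ≤ D)
    {u : κ → ℝ} (hu : ∀ k, u k ∈ Set.Icc (0 : ℝ) 1) :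
    |(T : ℝ)⁻¹ * ∑ t, ∏ k, (if u k ≤ x t k then 1 else 0) - ∏ k, (1 - u k)| ≤
      2 ^ Fintype.card κ * D := by
  classical
  have hT' : (0 : ℝ) < T := by exact_mod_cast hT
  have hD₁ := hD (fun _ => 1) fun _ => by simp
  set r : Fin T → ℝ := fun t => ∏ k, (if u k ≤ x t k then 1 else 0) -
    ∏ k, ((if x t k < 1 then 1 else 0) - (if x t k < u k then 1 else 0)) with hr
  have hr_bound (t : Fin T) : 0 ≤ r t ∧ r t ≤ 1 - ∏ k, (if x t k < 1 then 1 else 0) := by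
    by_cases h : ∀ k, x t k < 1
    · have : r t = 0 := by
        rw [hr]
        refine sub_eq_zero.2 (Finset.prod_congr rfl fun k _ => ?_)
        rw [if_pos (h k)]
        by_cases hk : u k ≤ x t k
        · simp [hk, hk.not_gt]
        · simp [hk, not_le.1 hk]
      simp [this, h]
    · obtain ⟨k, hk⟩ := not_forall.1 h
      have h₁ : ∏ k, ((if x t k < 1 then 1 else 0) - (if x t k < u k then 1 else 0) : ℝ) = 0 := by
        refine Finset.prod_eq_zero (Finset.mem_univ k) ?_
        rw [if_neg hk, if_neg fun h' => hk (h'.trans_le (hu k).2), sub_zero]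
      have h₂ : r t = ∏ k, (if u k ≤ x t k then 1 else 0) := by simp [hr, h₁]
      rw [h₂, Fintype.prod_ite_zero, Fintype.prod_ite_zero, if_neg h]
      split_ifs <;> simp
  have hsplit : (T : ℝ)⁻¹ * ∑ t, ∏ k, (if u k ≤ x t k then 1 else 0) - ∏ k, (1 - u k) =
      ((T : ℝ)⁻¹ * ∑ t, r t + localDiscrepancy x fun _ => 1) +
        ∑ s ∈ Finset.univ.erase (∅ : Finset κ),
          (-1) ^ s.card * localDiscrepancy x (fun k => if k ∈ s then u k else 1) := by
    have h := discrepancy_halfOpenBox_eq_sum x u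
    rw [← Finset.add_sum_erase _ _ (Finset.mem_univ (∅ : Finset κ))] at h
    simp only [Finset.card_empty, pow_zero, one_mul, Finset.notMem_empty, if_false] at h
    rw [add_assoc, ← h]
    simp only [hr, Finset.sum_sub_distrib]
    ring
  have hfull : |(T : ℝ)⁻¹ * ∑ t, r t + localDiscrepancy x fun _ => 1| ≤ D := by
    have hr₀ : 0 ≤ (T : ℝ)⁻¹ * ∑ t, r t :=
      mul_nonneg (by positivity) (Finset.sum_nonneg fun t _ => (hr_bound t).1)
    have hr₁ : (T : ℝ)⁻¹ * ∑ t, r t ≤ -localDiscrepancy x fun _ => 1 := by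
      calc (T : ℝ)⁻¹ * ∑ t, r t
          ≤ (T : ℝ)⁻¹ * ∑ t, (1 - ∏ k, (if x t k < 1 then 1 else 0)) := by
            gcongr with t
            exact (hr_bound t).2
        _ = -localDiscrepancy x fun _ => 1 := by
            simp only [localDiscrepancy, Finset.sum_sub_distrib, mul_sub, Finset.sum_const,
              Finset.card_univ, Fintype.card_fin, nsmul_eq_mul, mul_one, Finset.prod_const_one]
            rw [inv_mul_cancel₀ hT'.ne']
            ring
    rw [abs_le] at hD₁ ⊢
    constructor <;> linarith
  have hrest : |∑ s ∈ Finset.univ.erase (∅ : Finset κ),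
      (-1) ^ s.card * localDiscrepancy x (fun k => if k ∈ s then u k else 1)| ≤
        (2 ^ Fintype.card κ - 1) * D := by
    calc _ ≤ ∑ s ∈ Finset.univ.erase (∅ : Finset κ), D := by
          refine (Finset.abs_sum_le_sum_abs _ _).trans (Finset.sum_le_sum fun s _ => ?_)
          rw [abs_mul, abs_pow, abs_neg, abs_one, one_pow, one_mul]
          refine hD _ fun k => ?_
          split_ifs
          · exact hu k
          · simp
      _ = (2 ^ Fintype.card κ - 1) * D := by
          rw [Finset.sum_const, Finset.card_erase_of_mem (Finset.mem_univ _), Finset.card_univ,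
            Fintype.card_finset, nsmul_eq_mul, Nat.cast_sub Nat.one_le_two_pow]
          simp
  rw [hsplit]
  refine (abs_add_le _ _).trans ?_
  linarith

/-- The quantile function of the law with distribution function `x ↦ x ^ m` on `[0, 1]`. -/
noncomputable def powQuantile (m : ℕ) (v : ℝ) : ℝ :=
  if m = 0 then 0 else v ^ (m : ℝ)⁻¹

theorem powQuantile_mem_Icc (m : ℕ) {v : ℝ} (hv : v ∈ Set.Icc (0 : ℝ) 1) :
    powQuantile m v ∈ Set.Icc (0 : ℝ) 1 := by
  unfold powQuantile
  split_ifs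
  · simp
  · exact ⟨Real.rpow_nonneg hv.1 _, Real.rpow_le_one hv.1 hv.2 (by positivity)⟩

theorem powQuantile_le_iff (m : ℕ) {v y : ℝ} (hv : v ∈ Set.Icc (0 : ℝ) 1) (hy : 0 ≤ y) :
    powQuantile m v ≤ y ↔ v ≤ y ^ m := by
  unfold powQuantile
  split_ifs with hm
  · simp [hm, hy, hv.2]
  · rw [Real.rpow_inv_le_iff_of_pos hv.1 hy (by positivity), Real.rpow_natCast]

theorem continuous_powQuantile (m : ℕ) : Continuous (powQuantile m) := by
  unfold powQuantile
  split_ifs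
  · exact continuous_const
  · exact Real.continuous_rpow_const (by positivity)

theorem integrable_one_sub_powQuantile (m : ℕ) :
    Integrable fun v : I => 1 - powQuantile m v := by
  refine Continuous.integrable_of_hasCompactSupport ?_ (HasCompactSupport.of_compactSpace _)
  exact continuous_const.sub ((continuous_powQuantile m).comp continuous_subtype_val)

theorem integral_one_sub_powQuantile (m : ℕ) :
    ∫ v : I, (1 - powQuantile m v) = 1 / ((m : ℝ) + 1) := by
  rw [unitInterval.volume_def,
    integral_subtype_comap measurableSet_Icc fun v : ℝ => 1 - powQuantile m v,
    integral_Icc_eq_integral_Ioc, ← intervalIntegral.integral_of_le zero_le_one]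
  unfold powQuantile
  split_ifs with hm
  · simp [hm]
  · have hm' : (0 : ℝ) < m := by positivity
    have hpos : (0 : ℝ) < (m : ℝ)⁻¹ := by positivity
    rw [intervalIntegral.integral_sub (by simp)
      (intervalIntegral.intervalIntegrable_rpow' (by linarith)),
      integral_rpow (Or.inl (by linarith))]
    rw [Real.one_rpow, Real.zero_rpow (by positivity)]
    simp only [intervalIntegral.integral_const, sub_zero, smul_eq_mul, mul_one]
    field_simp
    ring

theorem integrable_indicator_powQuantile_le (m : ℕ) (y : ℝ) :
    Integrable fun v : I => if powQuantile m v ≤ y then (1 : ℝ) else 0 := by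
  have hmeas : MeasurableSet {v : I | powQuantile m v ≤ y} :=
    measurableSet_le ((continuous_powQuantile m).comp continuous_subtype_val).measurable
      measurable_const
  refine Integrable.of_bound (C := 1)
    (Measurable.ite hmeas measurable_const measurable_const).aestronglyMeasurable
    (ae_of_all _ fun v => ?_)
  split_ifs <;> simp

theorem integral_indicator_powQuantile_le (m : ℕ) {y : ℝ} (hy : y ∈ Set.Icc (0 : ℝ) 1) :
    ∫ v : I, (if powQuantile m v ≤ y then (1 : ℝ) else 0) = y ^ m := by
  have hym : y ^ m ∈ Set.Icc (0 : ℝ) 1 := ⟨pow_nonneg hy.1 m, pow_le_one₀ hy.1 hy.2⟩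
  have h : (fun v : I => if powQuantile m v ≤ y then (1 : ℝ) else 0) =
      (Set.Iic (⟨y ^ m, hym⟩ : I)).indicator 1 := by
    ext v
    simp [Set.indicator_apply, powQuantile_le_iff m v.2 hy.1, ← Subtype.coe_le_coe]
  rw [h, integral_indicator_one measurableSet_Iic, measureReal_def, unitInterval.volume_Iic,
    ENNReal.toReal_ofReal hym.1]

/-- Koksma-Hlawka type bound for monomials. -/
theorem abs_average_monomial_sub_integral_le {T : ℕ} {κ : Type*} [Fintype κ] (hT : 0 < T)
    {x : Fin T → κ → ℝ} (hx : ∀ t k, x t k ∈ Set.Icc (0 : ℝ) 1) {D : ℝ}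
    (hD : ∀ a : κ → ℝ, (∀ k, a k ∈ Set.Icc (0 : ℝ) 1) → |localDiscrepancy x a| ≤ D)
    (n : κ → ℕ) :
    |(T : ℝ)⁻¹ * ∑ t, ∏ k, x t k ^ n k - ∏ k, 1 / ((n k : ℝ) + 1)| ≤
      2 ^ Fintype.card κ * D := by
  have hint (t : Fin T) : Integrable fun v : κ → I =>
      ∏ k, if powQuantile (n k) (v k) ≤ x t k then (1 : ℝ) else 0 :=
    Integrable.fintype_prod fun k => integrable_indicator_powQuantile_le (n k) (x t k)
  have hvol : Integrable fun v : κ → I => ∏ k, (1 - powQuantile (n k) (v k)) :=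
    Integrable.fintype_prod fun k => integrable_one_sub_powQuantile (n k)
  have hrepr : (T : ℝ)⁻¹ * ∑ t, ∏ k, x t k ^ n k - ∏ k, 1 / ((n k : ℝ) + 1) =
      ∫ v : κ → I, ((T : ℝ)⁻¹ *
        ∑ t, ∏ k, (if powQuantile (n k) (v k) ≤ x t k then (1 : ℝ) else 0) -
          ∏ k, (1 - powQuantile (n k) (v k))) := by
    rw [integral_sub ((integrable_finsetSum _ fun t _ => hint t).const_mul _) hvol,
      integral_const_mul, integral_finsetSum _ fun t _ => hint t,
      integral_fintype_prod_volume_eq_prod fun k (v : I) => 1 - powQuantile (n k) v]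
    simp_rw [integral_one_sub_powQuantile]
    congr 2
    refine Finset.sum_congr rfl fun t _ => ?_
    rw [integral_fintype_prod_volume_eq_prod fun k (v : I) =>
      if powQuantile (n k) v ≤ x t k then (1 : ℝ) else 0]
    exact Finset.prod_congr rfl fun k _ => (integral_indicator_powQuantile_le (n k) (hx t k)).symm
  rw [hrepr]
  have hbound (v : κ → I) := abs_discrepancy_closedBox_le hT hD
    fun k => powQuantile_mem_Icc (n k) (v k).2
  simp_rw [← Real.norm_eq_abs] at hbound ⊢
  refine (norm_integral_le_of_norm_le_const (ae_of_all _ hbound)).trans_eq ?_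
  simp

/-- The Frobenius norm of a square matrix is at most its size times a bound on its entries. -/
theorem sqrt_sum_sq_le_card_mul {ι : Type*} [Fintype ι] {A : Matrix ι ι ℝ} {C : ℝ} (hC : 0 ≤ C)
    (hA : ∀ i j, |A i j| ≤ C) :
    Real.sqrt (∑ i, ∑ j, A i j ^ 2) ≤ Fintype.card ι * C := by
  refine Real.sqrt_le_iff.2 ⟨by positivity, ?_⟩
  calc ∑ i, ∑ j, A i j ^ 2 ≤ ∑ _i : ι, ∑ _j : ι, C ^ 2 :=
        Finset.sum_le_sum fun i _ => Finset.sum_le_sum fun j _ =>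
          sq_le_sq' (abs_le.1 (hA i j)).1 (abs_le.1 (hA i j)).2
    _ = (Fintype.card ι * C) ^ 2 := by
        simp only [Finset.sum_const, Finset.card_univ, nsmul_eq_mul]
        ring

theorem gram_matrix_discrepancy_bound
    (T P d : ℕ) (hT : 0 < T) (hP : 0 < P) (hd : 0 < d)
    (x : Fin T → Fin d → ℝ) (hx : ∀ t k, x t k ∈ Set.Icc (0 : ℝ) 1)
    -- `ι` enumerates the set `Λ` of multi-indices, `|Λ| = P`
    (ι : Fin P → (Fin d → ℕ)) (hι : Function.Injective ι)
    (Ψ : Matrix (Fin T) (Fin P) ℝ)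
    (hΨ : ∀ t p, Ψ t p = ∏ k, (x t k) ^ (ι p k))
    (Q : Matrix (Fin P) (Fin P) ℝ)
    (hQ : ∀ p p', Q p p' = ∏ k, (1 : ℝ) / ((ι p k : ℝ) + (ι p' k : ℝ) + 1))
    -- the star discrepancy of the point set
    (Dstar : ℝ)
    (hD : Dstar = ⨆ a : {a : Fin d → ℝ // ∀ k, a k ∈ Set.Icc (0 : ℝ) 1},
        |(T : ℝ)⁻¹ * (Set.ncard {t : Fin T | ∀ k, x t k < a.1 k} : ℝ) -
          ∏ k, a.1 k|) :
    Real.sqrt (∑ p, ∑ p', (((T : ℝ)⁻¹ • (Ψᵀ * Ψ) - Q) p p') ^ 2) ≤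
      (P : ℝ) * 2 ^ d * Dstar := by
  have hbdd : BddAbove (Set.range fun a : {a : Fin d → ℝ // ∀ k, a k ∈ Set.Icc (0 : ℝ) 1} =>
      |localDiscrepancy x a.1|) :=
    ⟨1, Set.forall_mem_range.2 fun a => abs_localDiscrepancy_le_one hT x a.2⟩
  have hDstar (a : Fin d → ℝ) (ha : ∀ k, a k ∈ Set.Icc (0 : ℝ) 1) :
      |localDiscrepancy x a| ≤ Dstar := by
    simp_rw [← localDiscrepancy_eq_ncard] at hD
    rw [hD]
    exact le_ciSup hbdd ⟨a, ha⟩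
  have hDstar₀ : 0 ≤ Dstar := (abs_nonneg _).trans (hDstar (fun _ => 1) fun _ => by simp)
  have hentry (p p' : Fin P) : |((T : ℝ)⁻¹ • (Ψᵀ * Ψ) - Q) p p'| ≤ 2 ^ d * Dstar := by
    have h := abs_average_monomial_sub_integral_le hT hx hDstar fun k => ι p k + ι p' k
    simpa [Matrix.mul_apply, hΨ, hQ, pow_add, Finset.prod_mul_distrib] using h
  have h := sqrt_sum_sq_le_card_mul (by positivity) hentry
  rwa [Fintype.card_fin, ← mul_assoc] at h
end
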